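/- arXiv:1407.0889 — 2 statements merged into one kernel-verified Lean document; each statement's English description precedes it below -/
import Mathlib

section
/- Let (u_k)_{k≥0} be the iteration defined by: u_k = F on Γ_ε for all k, u_0 = inf_{Γ_ε} F on Ω, and u_{k+1}(x) = (α/2)(sup_{B_ε(x)} u_k + inf_{B_ε(x)} u_k) + β ⨍_{B_ε(x)} u_k(y) dy + ε² f(x) for all x ∈ Ω and k ≥ 0. If f > 0, then (u_k) converges uniformly on Ω_ε to a bounded Borel measurable function u, and this limit u satisfies the DPP u(x) = (α/2)(sup_{B_ε(x)} u + inf_{B_ε(x)} u) + β ⨍_{B_ε(x)} u(y) dy + ε² f(x) for every x ∈ Ω. -/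
open MeasureTheory Metric Set Filter ProbabilityTheory

noncomputable section

/-- Euclidean space `ℝⁿ`. -/
abbrev En (n : ℕ) := EuclideanSpace ℝ (Fin n)

/-- The boundary strip `Γ_ε = {x ∈ ℝⁿ \ Ω : dist(x, ∂Ω) ≤ ε}`. -/
def bdryStrip (n : ℕ) (Ω : Set (En n)) (ε : ℝ) : Set (En n) :=
  {x | x ∉ Ω ∧ Metric.infDist x (frontier Ω) ≤ ε}

/-- The dynamic programming principle (DPP) with running payoff `f`:
`u x = (α/2)(sup_{B_ε(x)} u + inf_{B_ε(x)} u) + β ⨍_{B_ε(x)} u + ε² f x` for all `x ∈ Ω`. -/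
def SatisfiesDPP (n : ℕ) (α β ε : ℝ) (Ω : Set (En n)) (f u : En n → ℝ) : Prop :=
  ∀ x ∈ Ω, u x =
    α / 2 * (sSup (u '' Metric.ball x ε) + sInf (u '' Metric.ball x ε))
      + β * (⨍ y in Metric.ball x ε, u y) + ε ^ 2 * f x

/-- The averaging operator of the DPP:
`(α/2)(sup_{B_ε(x)} w + inf_{B_ε(x)} w) + β ⨍_{B_ε(x)} w`. -/
def dppOp {n : ℕ} (α β ε : ℝ) (w : En n → ℝ) (x : En n) : ℝ :=
  α / 2 * (sSup (w '' Metric.ball x ε) + sInf (w '' Metric.ball x ε))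
    + β * (⨍ y in Metric.ball x ε, w y)

theorem bddAbove_image_of_abs_le {X : Type*} {w : X → ℝ} {s : Set X} {C : ℝ}
    (h : ∀ y ∈ s, |w y| ≤ C) : BddAbove (w '' s) :=
  ⟨C, forall_mem_image.2 fun y hy => (abs_le.1 (h y hy)).2⟩

theorem bddBelow_image_of_abs_le {X : Type*} {w : X → ℝ} {s : Set X} {C : ℝ}
    (h : ∀ y ∈ s, |w y| ≤ C) : BddBelow (w '' s) :=
  ⟨-C, forall_mem_image.2 fun y hy => (abs_le.1 (h y hy)).1⟩

theorem sSup_image_le_add {X : Type*} {w₁ w₂ : X → ℝ} {s : Set X} {c : ℝ} (hs : s.Nonempty)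
    (h₁ : BddAbove (w₁ '' s)) (h : ∀ y ∈ s, w₂ y ≤ w₁ y + c) :
    sSup (w₂ '' s) ≤ sSup (w₁ '' s) + c :=
  csSup_le (hs.image _) (forall_mem_image.2 fun y hy =>
    (h y hy).trans (by have := le_csSup h₁ (mem_image_of_mem w₁ hy); linarith))

theorem sInf_image_le_add {X : Type*} {w₁ w₂ : X → ℝ} {s : Set X} {c : ℝ} (hs : s.Nonempty)
    (h₂ : BddBelow (w₂ '' s)) (h : ∀ y ∈ s, w₂ y ≤ w₁ y + c) :
    sInf (w₂ '' s) ≤ sInf (w₁ '' s) + c := by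
  have : sInf (w₂ '' s) - c ≤ sInf (w₁ '' s) :=
    le_csInf (hs.image _) (forall_mem_image.2 fun y hy => by
      have := csInf_le h₂ (mem_image_of_mem w₂ hy)
      linarith [h y hy])
  linarith

theorem integrableOn_ball_of_abs_le {n : ℕ} {w : En n → ℝ} {x : En n} {ε C : ℝ}
    (hw : Measurable w) (h : ∀ y ∈ ball x ε, |w y| ≤ C) : IntegrableOn w (ball x ε) :=
  IntegrableOn.of_bound measure_ball_lt_top hw.aestronglyMeasurable C
    ((ae_restrict_iff' measurableSet_ball).2 (.of_forall fun y hy => h y hy))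

theorem volume_real_ball_pos {n : ℕ} (x : En n) {ε : ℝ} (hε : 0 < ε) :
    0 < volume.real (ball x ε) :=
  ENNReal.toReal_pos (measure_ball_pos _ _ hε).ne' measure_ball_lt_top.ne

theorem setAverage_ball_const {n : ℕ} (x : En n) {ε : ℝ} (hε : 0 < ε) (c : ℝ) :
    (⨍ _ in ball x ε, c) = c :=
  setAverage_const (measure_ball_pos _ _ hε).ne' measure_ball_lt_top.ne c

section Comparison

variable {n : ℕ} {α β ε : ℝ} {w₁ w₂ : En n → ℝ} {x : En n} {c C₁ C₂ : ℝ}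

theorem dppOp_le_add_average (hε : 0 < ε) (hα : 0 ≤ α)
    (b₁ : ∀ y ∈ ball x ε, |w₁ y| ≤ C₁) (b₂ : ∀ y ∈ ball x ε, |w₂ y| ≤ C₂)
    (h : ∀ y ∈ ball x ε, w₂ y ≤ w₁ y + c) :
    dppOp α β ε w₂ x ≤ dppOp α β ε w₁ x + α * c
      + β * ((⨍ y in ball x ε, w₂ y) - ⨍ y in ball x ε, w₁ y) := by
  have hne : (ball x ε).Nonempty := nonempty_ball.2 hε
  have h1 := sSup_image_le_add hne (bddAbove_image_of_abs_le b₁) h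
  have h2 := sInf_image_le_add hne (bddBelow_image_of_abs_le b₂) h
  have h3 := mul_le_mul_of_nonneg_left (add_le_add h1 h2) (by positivity : 0 ≤ α / 2)
  unfold dppOp
  linarith

theorem dppOp_le_add (hε : 0 < ε) (hα : 0 ≤ α) (hβ : 0 ≤ β) (hαβ : α + β = 1)
    (m₁ : Measurable w₁) (m₂ : Measurable w₂)
    (b₁ : ∀ y ∈ ball x ε, |w₁ y| ≤ C₁) (b₂ : ∀ y ∈ ball x ε, |w₂ y| ≤ C₂)
    (h : ∀ y ∈ ball x ε, w₂ y ≤ w₁ y + c) :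
    dppOp α β ε w₂ x ≤ dppOp α β ε w₁ x + c := by
  have hv := volume_real_ball_pos x hε
  have i₁ := integrableOn_ball_of_abs_le m₁ b₁
  have i₂ := integrableOn_ball_of_abs_le m₂ b₂
  have ic : IntegrableOn (fun _ => c) (ball x ε) :=
    integrableOn_const measure_ball_lt_top.ne
  have key : (⨍ y in ball x ε, w₂ y) - (⨍ y in ball x ε, w₁ y) ≤ c := by
    have hi : ∫ y in ball x ε, w₂ y ≤ ∫ y in ball x ε, (w₁ y + c) :=
      setIntegral_mono_on i₂ (i₁.add ic) measurableSet_ball h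
    rw [integral_add i₁ ic, setIntegral_const, smul_eq_mul] at hi
    rw [setAverage_eq, setAverage_eq, smul_eq_mul, smul_eq_mul, ← mul_sub,
      inv_mul_le_iff₀ hv]
    linarith
  have h1 := dppOp_le_add_average (β := β) hε hα b₁ b₂ h
  have h2 := mul_le_mul_of_nonneg_left key hβ
  have h3 : α * c + β * c = c := by rw [← add_mul, hαβ, one_mul]
  linarith

theorem dppOp_mono (hε : 0 < ε) (hα : 0 ≤ α) (hβ : 0 ≤ β) (hαβ : α + β = 1)
    (m₁ : Measurable w₁) (m₂ : Measurable w₂)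
    (b₁ : ∀ y ∈ ball x ε, |w₁ y| ≤ C₁) (b₂ : ∀ y ∈ ball x ε, |w₂ y| ≤ C₂)
    (h : ∀ y ∈ ball x ε, w₁ y ≤ w₂ y) :
    dppOp α β ε w₁ x ≤ dppOp α β ε w₂ x := by
  simpa using dppOp_le_add (c := 0) hε hα hβ hαβ m₂ m₁ b₂ b₁ (by simpa using h)

theorem dppOp_const (hε : 0 < ε) (hαβ : α + β = 1) (x : En n) (c : ℝ) :
    dppOp α β ε (fun _ => c) x = c := by
  have hne : (ball x ε).Nonempty := nonempty_ball.2 hε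
  rw [dppOp, hne.image_const, csSup_singleton, csInf_singleton, setAverage_ball_const x hε]
  linear_combination c * hαβ

theorem abs_dppOp_le (hε : 0 < ε) (hα : 0 ≤ α) (hβ : 0 ≤ β) (hαβ : α + β = 1)
    (m₁ : Measurable w₁) (b₁ : ∀ y ∈ ball x ε, |w₁ y| ≤ C₁) :
    |dppOp α β ε w₁ x| ≤ C₁ := by
  refine abs_le.2 ⟨?_, ?_⟩
  · rw [← dppOp_const hε hαβ x (-C₁)]
    exact dppOp_mono hε hα hβ hαβ measurable_const m₁ (fun _ _ => le_rfl) b₁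
      fun y hy => (abs_le.1 (b₁ y hy)).1
  · rw [← dppOp_const hε hαβ x C₁]
    exact dppOp_mono hε hα hβ hαβ m₁ measurable_const b₁ (fun _ _ => le_rfl)
      fun y hy => (abs_le.1 (b₁ y hy)).2

end Comparison

section Measurability

variable {n : ℕ} {w : En n → ℝ} {ε C : ℝ}

theorem lowerSemicontinuous_sSup_image_ball (hε : 0 < ε) (b : ∀ y, |w y| ≤ C) :
    LowerSemicontinuous fun x => sSup (w '' ball x ε) := by
  intro x a ha
  obtain ⟨_, ⟨y, hy, rfl⟩, hlt⟩ := exists_lt_of_lt_csSup ((nonempty_ball.2 hε).image w) ha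
  have hnear : ∀ᶠ z in nhds x, z ∈ ball y ε :=
    isOpen_ball.mem_nhds (mem_ball_comm.1 hy)
  filter_upwards [hnear] with z hz
  exact hlt.trans_le (le_csSup (bddAbove_image_of_abs_le fun y _ => b y)
    (mem_image_of_mem w (mem_ball_comm.1 hz)))

theorem measurable_sSup_image_ball (hε : 0 < ε) (b : ∀ y, |w y| ≤ C) :
    Measurable fun x => sSup (w '' ball x ε) :=
  (lowerSemicontinuous_sSup_image_ball hε b).measurable

theorem measurable_sInf_image_ball (hε : 0 < ε) (b : ∀ y, |w y| ≤ C) :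
    Measurable fun x => sInf (w '' ball x ε) := by
  have h := (measurable_sSup_image_ball (w := fun y => -w y) hε
    (fun y => by simpa using b y)).neg
  convert h using 2 with x
  rw [Pi.neg_apply, Real.sInf_def, ← Set.image_neg_eq_neg, Set.image_image]

theorem measurable_setAverage_ball (hw : Measurable w) :
    Measurable fun x => ⨍ y in ball x ε, w y := by
  have hmeas : Measurable fun q : En n × En n => (ball q.1 ε).indicator w q.2 := by
    have hs : MeasurableSet {q : En n × En n | q.2 ∈ ball q.1 ε} :=
      (isOpen_lt (continuous_snd.dist continuous_fst) continuous_const).measurableSet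
    exact (hw.comp measurable_snd).indicator hs
  have hint : Measurable fun x => ∫ y in ball x ε, w y := by
    have := StronglyMeasurable.integral_prod_right (ν := (volume : Measure (En n)))
      (f := fun x => (ball x ε).indicator w) hmeas.stronglyMeasurable
    simpa only [integral_indicator measurableSet_ball] using this.measurable
  have hvol : ∀ x : En n, volume.real (ball x ε) = volume.real (ball (0 : En n) ε) := fun x => by
    rw [measureReal_def, measureReal_def, Measure.addHaar_ball_center]
  simp only [setAverage_eq, hvol]
  exact hint.const_mul _

theorem measurable_dppOp (α β : ℝ) (hε : 0 < ε) (hw : Measurable w) (b : ∀ y, |w y| ≤ C) :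
    Measurable (dppOp α β ε w) :=
  (((measurable_sSup_image_ball hε b).add (measurable_sInf_image_ball hε b)).const_mul _).add
    ((measurable_setAverage_ball hw).const_mul _)

end Measurability

section Barrier

variable {n : ℕ} {ε : ℝ}

theorem setAverage_ball_le_of_midpoint {v : En n → ℝ} {x : En n} (hε : 0 < ε)
    (hv : Continuous v) (h : ∀ y, v y + v (x + x - y) ≤ 2 * v x) :
    (⨍ y in ball x ε, v y) ≤ v x := by
  have hrefl : ∀ y, x + x - y ∈ ball x ε ↔ y ∈ ball x ε := fun y => by
    rw [mem_ball_iff_norm, mem_ball_iff_norm']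
    congr! 2
    abel
  have hI : ∀ g : En n → ℝ, Continuous g → IntegrableOn g (ball x ε) := fun g hg =>
    (hg.continuousOn.integrableOn_compact (isCompact_closedBall x ε)).mono_set
      ball_subset_closedBall
  have hsymm : ∫ y in ball x ε, v (x + x - y) = ∫ y in ball x ε, v y := by
    rw [← integral_indicator measurableSet_ball, ← integral_indicator measurableSet_ball,
      ← integral_sub_left_eq_self ((ball x ε).indicator v) volume (x + x)]
    refine integral_congr_ae (.of_forall fun y => ?_)
    beta_reduce
    by_cases hy : y ∈ ball x ε
    · rw [indicator_of_mem hy, indicator_of_mem ((hrefl y).2 hy)]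
    · rw [indicator_of_notMem hy, indicator_of_notMem (mt (hrefl y).1 hy)]
  have hle : ∫ y in ball x ε, (v y + v (x + x - y)) ≤ ∫ _ in ball x ε, 2 * v x :=
    setIntegral_mono_on ((hI _ hv).add (hI _ (by fun_prop))) (hI _ continuous_const)
      measurableSet_ball fun y _ => h y
  rw [integral_add (hI _ hv) (hI _ (by fun_prop)), hsymm, setIntegral_const, smul_eq_mul] at hle
  rw [setAverage_eq, smul_eq_mul, inv_mul_le_iff₀ (volume_real_ball_pos x hε)]
  linarith

theorem sSup_add_sInf_image_ball_le (hε : 0 < ε) {A B : ℝ} (hB : 0 ≤ B) {x z : En n}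
    (hx : ε ≤ ‖x - z‖) :
    sSup ((fun y => A - B * ‖y - z‖ ^ 2) '' ball x ε)
      + sInf ((fun y => A - B * ‖y - z‖ ^ 2) '' ball x ε)
      ≤ 2 * (A - B * ‖x - z‖ ^ 2) - 2 * (B * ε ^ 2) := by
  set r := ‖x - z‖ with hr
  set v : En n → ℝ := fun y => A - B * ‖y - z‖ ^ 2 with hv
  have hr0 : 0 < r := hε.trans_le hx
  have hvc : Continuous v := by fun_prop
  have hsup : sSup (v '' ball x ε) ≤ A - B * (r - ε) ^ 2 := by
    refine csSup_le ((nonempty_ball.2 hε).image v) (forall_mem_image.2 fun y hy => ?_)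
    have h1 : r - ε ≤ ‖y - z‖ := by
      have h2 : r ≤ ‖x - y‖ + ‖y - z‖ := norm_sub_le_norm_sub_add_norm_sub x y z
      have h3 := mem_ball_iff_norm'.1 hy
      linarith
    have h4 : (r - ε) ^ 2 ≤ ‖y - z‖ ^ 2 := pow_le_pow_left₀ (by linarith) h1 2
    have h5 := mul_le_mul_of_nonneg_left h4 hB
    simp only [hv]
    linarith
  have hinf : sInf (v '' ball x ε) ≤ A - B * (r + ε) ^ 2 := by
    have hbdd : BddBelow (v '' ball x ε) :=
      ((isCompact_closedBall x ε).image hvc).bddBelow.mono (image_mono ball_subset_closedBall)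
    have hcl : closedBall x ε ⊆ {y | sInf (v '' ball x ε) ≤ v y} := by
      rw [← closure_ball x hε.ne']
      exact closure_minimal (fun y hy => csInf_le hbdd (mem_image_of_mem v hy))
        (isClosed_le continuous_const hvc)
    have hmem : x + (ε / r) • (x - z) ∈ closedBall x ε := by
      rw [mem_closedBall_iff_norm, add_sub_cancel_left, norm_smul, ← hr, Real.norm_eq_abs,
        abs_of_pos (by positivity), div_mul_cancel₀ _ hr0.ne']
    have hnorm : ‖x + (ε / r) • (x - z) - z‖ = r + ε := by
      have : x + (ε / r) • (x - z) - z = (1 + ε / r) • (x - z) := by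
        rw [add_smul, one_smul]; abel
      rw [this, norm_smul, ← hr, Real.norm_eq_abs, abs_of_pos (by positivity)]
      field_simp
    have := hcl hmem
    simpa only [mem_ofPred_eq, hv, hnorm] using this
  calc _ ≤ (A - B * (r - ε) ^ 2) + (A - B * (r + ε) ^ 2) := add_le_add hsup hinf
    _ = _ := by ring

/-- A quadratic strict supersolution of the DPP. -/
theorem exists_dppOp_supersolution (hn : n ≠ 0) (hε : 0 < ε) {α β : ℝ} (hα : 0 < α)
    (hβ : 0 ≤ β) (hαβ : α + β = 1) {R D : ℝ} (hR : 0 ≤ R) (hD : 0 ≤ D) (K : ℝ) :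
    ∃ (v : En n → ℝ) (C : ℝ), Continuous v ∧ (∀ x, v x ≤ C) ∧
      (∀ x ∈ closedBall (0 : En n) (R + ε), K ≤ v x) ∧
      ∀ x ∈ closedBall (0 : En n) R, dppOp α β ε v x + D ≤ v x := by
  have : Nonempty (Fin n) := ⟨⟨0, Nat.pos_of_ne_zero hn⟩⟩
  obtain ⟨z, hz⟩ := exists_norm_eq (En n) (by positivity : 0 ≤ R + ε)
  obtain ⟨B, hB, hBD⟩ : ∃ B, 0 ≤ B ∧ α * (B * ε ^ 2) = D :=
    ⟨D / (α * ε ^ 2), by positivity, by field_simp⟩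
  set A := K + B * (2 * (R + ε)) ^ 2 with hA
  have hv : Continuous fun y : En n => A - B * ‖y - z‖ ^ 2 := by fun_prop
  refine ⟨fun y => A - B * ‖y - z‖ ^ 2, A, hv, fun x => ?_, fun x hx => ?_, fun x hx => ?_⟩
  · exact sub_le_self _ (by positivity)
  · have h1 : ‖x - z‖ ≤ 2 * (R + ε) := by
      have := norm_sub_le x z
      have := mem_closedBall_zero_iff.1 hx
      linarith
    have h2 := mul_le_mul_of_nonneg_left (pow_le_pow_left₀ (norm_nonneg _) h1 2) hB
    linarith
  · have hxz : ε ≤ ‖x - z‖ := by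
      have h1 := norm_sub_norm_le z x
      have h2 := mem_closedBall_zero_iff.1 hx
      rw [norm_sub_rev] at h1
      linarith
    have h1 := sSup_add_sInf_image_ball_le hε (A := A) hB hxz
    have h2 : (⨍ y in ball x ε, (A - B * ‖y - z‖ ^ 2)) ≤ A - B * ‖x - z‖ ^ 2 := by
      refine setAverage_ball_le_of_midpoint hε hv fun y => ?_
      have hpar := parallelogram_law_with_norm ℝ (x - z) (y - x)
      have e1 : x - z + (y - x) = y - z := by abel
      have e2 : x - z - (y - x) = x + x - y - z := by abel
      rw [e1, e2] at hpar
      have h3 : 2 * ‖x - z‖ ^ 2 ≤ ‖y - z‖ ^ 2 + ‖x + x - y - z‖ ^ 2 := by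
        nlinarith [mul_self_nonneg ‖y - x‖]
      have h4 := mul_le_mul_of_nonneg_left h3 hB
      linarith
    have h3 := mul_le_mul_of_nonneg_left h1 (by positivity : 0 ≤ α / 2)
    have h4 := mul_le_mul_of_nonneg_left h2 hβ
    have h5 : α * (A - B * ‖x - z‖ ^ 2) + β * (A - B * ‖x - z‖ ^ 2) = A - B * ‖x - z‖ ^ 2 := by
      rw [← add_mul, hαβ, one_mul]
    unfold dppOp
    linarith

end Barrier

theorem IsPreconnected.inter_frontier_nonempty_of_isOpen {X : Type*} [TopologicalSpace X]
    {s u : Set X} (hs : IsPreconnected s) (hu : IsOpen u) (h : (s ∩ u).Nonempty)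
    (h' : ¬ s ⊆ u) : (s ∩ frontier u).Nonempty := by
  contrapose! h'
  refine hs.subset_of_closure_inter_subset hu h fun z hz => ?_
  by_contra hzu
  have : z ∈ s ∩ frontier u := ⟨hz.2, by rw [hu.frontier_eq]; exact ⟨hz.1, hzu⟩⟩
  rwa [h'] at this

theorem ball_subset_union_bdryStrip {n : ℕ} {Ω : Set (En n)} (hΩ : IsOpen Ω) {ε : ℝ} {x : En n}
    (hx : x ∈ Ω) :
    ball x ε ⊆ Ω ∪ bdryStrip n Ω ε := by
  intro y hy
  by_cases hyΩ : y ∈ Ω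
  · exact Or.inl hyΩ
  refine Or.inr ⟨hyΩ, ?_⟩
  obtain ⟨z, hz, hzf⟩ := (convex_segment x y).isPreconnected.inter_frontier_nonempty_of_isOpen
    hΩ ⟨x, left_mem_segment ℝ x y, hx⟩ fun h => hyΩ (h (right_mem_segment ℝ x y))
  have hzy : dist z y ≤ dist x y :=
    (convex_closedBall y (dist x y)).segment_subset (mem_closedBall.2 le_rfl)
      (mem_closedBall_self dist_nonneg) hz
  calc infDist y (frontier Ω) ≤ dist y z := infDist_le_dist_of_mem hzf
    _ ≤ dist y x := by rwa [dist_comm y z, dist_comm y x]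
    _ ≤ ε := (mem_ball.1 hy).le

theorem measurableSet_bdryStrip {n : ℕ} {Ω : Set (En n)} (hΩ : IsOpen Ω) (ε : ℝ) :
    MeasurableSet (bdryStrip n Ω ε) :=
  hΩ.measurableSet.compl.inter
    (isClosed_le (continuous_infDist_pt _) continuous_const).measurableSet

theorem tendsto_zero_of_le_mul_add {M e : ℕ → ℝ} {α : ℝ} (hα : α < 1) (hM0 : ∀ k, 0 ≤ M k)
    (hM : Antitone M) (he : Tendsto e atTop (nhds 0)) (h : ∀ k, M (k + 1) ≤ α * M k + e k) :
    Tendsto M atTop (nhds 0) := by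
  have hlim : Tendsto M atTop (nhds (⨅ k, M k)) :=
    tendsto_atTop_ciInf hM ⟨0, forall_mem_range.2 hM0⟩
  have hle := le_of_tendsto_of_tendsto' (hlim.comp (tendsto_add_atTop_nat 1))
    ((hlim.const_mul α).add he) h
  have h0 : 0 ≤ ⨅ k, M k := le_ciInf hM0
  have : ⨅ k, M k = 0 := by nlinarith
  rwa [this] at hlim

/-- A bounded increasing sequence of functions that is produced on `Ω` by the DPP operator, and is
constant in `k` off `Ω`, converges uniformly to a solution of the DPP. -/
theorem exists_uniform_limit_of_monotone_iteration {n : ℕ} {Ω : Set (En n)} (hΩ : IsOpen Ω)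
    (hΩbdd : Bornology.IsBounded Ω) {α β ε C : ℝ} (hε : 0 < ε) (hα : 0 ≤ α) (hβ : 0 < β)
    (hαβ : α + β = 1) {g : En n → ℝ} {V : ℕ → En n → ℝ} (hmeas : ∀ k, Measurable (V k))
    (hbdd : ∀ k x, |V k x| ≤ C) (hmono : Monotone V)
    (hout : ∀ k, ∀ x ∉ Ω, V (k + 1) x = V k x)
    (hrec : ∀ k, ∀ x ∈ Ω, V (k + 1) x = dppOp α β ε (V k) x + g x) :
    ∃ u : En n → ℝ, Measurable u ∧ (∀ x, |u x| ≤ C) ∧ TendstoUniformly V u atTop ∧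
      ∀ x ∈ Ω, u x = dppOp α β ε u x + g x := by
  have hV : ∀ x, Monotone fun k => V k x := fun x _ _ h => hmono h x
  have hVb : ∀ x, BddAbove (range fun k => V k x) := fun x =>
    ⟨C, forall_mem_range.2 fun k => (abs_le.1 (hbdd k x)).2⟩
  set u : En n → ℝ := fun x => ⨆ k, V k x with hu
  have hlim : ∀ x, Tendsto (fun k => V k x) atTop (nhds (u x)) := fun x =>
    tendsto_atTop_ciSup (hV x) (hVb x)
  have humeas : Measurable u := measurable_of_tendsto_metrizable hmeas (tendsto_pi_nhds.2 hlim)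
  have hle : ∀ k x, V k x ≤ u x := fun k x => le_ciSup (hVb x) k
  have hub : ∀ x, |u x| ≤ C := fun x =>
    le_of_tendsto' (hlim x).abs fun k => hbdd k x
  have hout' : ∀ k, ∀ x ∉ Ω, V k x = u x := by
    intro k x hx
    have hconst : ∀ j, V j x = V 0 x := fun j => by
      induction j with
      | zero => rfl
      | succ j ih => rw [hout j x hx, ih]
    simp only [hu, hconst, ciSup_const]
  have hdiff : ∀ k x, u x - V k x ≤ 2 * C := fun k x => by
    linarith [(abs_le.1 (hub x)).2, (abs_le.1 (hbdd k x)).1]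
  set M : ℕ → ℝ := fun k => ⨆ x, (u x - V k x) with hMdef
  have hMb : ∀ k, BddAbove (range fun x => u x - V k x) := fun k =>
    ⟨2 * C, forall_mem_range.2 (hdiff k)⟩
  have hleM : ∀ k x, u x ≤ V k x + M k := fun k x => by
    have := le_ciSup (hMb k) x
    simp only [hMdef]
    linarith
  have hM0 : ∀ k, 0 ≤ M k := fun k => by linarith [hleM k 0, hle k 0]
  have hManti : Antitone M := fun j k hjk =>
    ciSup_mono (hMb j) fun x => by linarith [hV x hjk]
  have hΩfin : volume Ω ≠ ⊤ := hΩbdd.measure_lt_top.ne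
  set c : ℝ := (volume.real (ball (0 : En n) ε))⁻¹ with hc
  have hvol : ∀ x : En n, (volume.real (ball x ε))⁻¹ = c := fun x => by
    rw [hc, measureReal_def, measureReal_def, Measure.addHaar_ball_center]
  have hc0 : 0 ≤ c := inv_nonneg.2 measureReal_nonneg
  set I : ℕ → ℝ := fun k => ∫ y in Ω, (u y - V k y) with hI
  have hint : ∀ k, IntegrableOn (fun y => u y - V k y) Ω := fun k =>
    IntegrableOn.of_bound hΩfin.lt_top (humeas.sub (hmeas k)).aestronglyMeasurable (2 * C)
      (.of_forall fun y => by
        rw [Real.norm_eq_abs, abs_of_nonneg (sub_nonneg.2 (hle k y))]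
        exact hdiff k y)
  have hI0 : Tendsto I atTop (nhds 0) := by
    have h := tendsto_integral_of_dominated_convergence (μ := volume.restrict Ω)
      (F := fun k y => u y - V k y) (f := fun _ => (0 : ℝ)) (fun _ => 2 * C)
      (fun k => (humeas.sub (hmeas k)).aestronglyMeasurable)
      (integrableOn_const hΩfin)
      (fun k => .of_forall fun y => by
        rw [Real.norm_eq_abs, abs_of_nonneg (sub_nonneg.2 (hle k y))]
        exact hdiff k y)
      (.of_forall fun y => by simpa using (tendsto_const_nhds (x := u y)).sub (hlim y))
    simpa using h
  have havg : ∀ k x, (⨍ y in ball x ε, u y) - (⨍ y in ball x ε, V k y) ≤ c * I k := by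
    intro k x
    have iu := integrableOn_ball_of_abs_le (x := x) (ε := ε) humeas fun y _ => hub y
    have iV := integrableOn_ball_of_abs_le (x := x) (ε := ε) (hmeas k) fun y _ => hbdd k y
    rw [setAverage_eq, setAverage_eq, hvol, smul_eq_mul, smul_eq_mul, ← mul_sub,
      ← integral_sub iu iV]
    refine mul_le_mul_of_nonneg_left ?_ hc0
    have hzero : (fun y => u y - V k y) = Ω.indicator fun y => u y - V k y := by
      funext y
      by_cases hy : y ∈ Ω
      · rw [indicator_of_mem hy]
      · rw [indicator_of_notMem hy, hout' k y hy, sub_self]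
    have hi : Integrable (fun y => u y - V k y) := by
      rw [hzero]
      exact (integrable_indicator_iff hΩ.measurableSet).2 (hint k)
    have hIk : I k = ∫ y, (u y - V k y) := by
      rw [hzero, integral_indicator hΩ.measurableSet]
    rw [hIk]
    exact setIntegral_le_integral hi (.of_forall fun y => sub_nonneg.2 (hle k y))
  have hstep : ∀ k, M (k + 1) ≤ α * M k + β * (c * I k) := by
    intro k
    have hIk : 0 ≤ I k := integral_nonneg fun y => sub_nonneg.2 (hle k y)
    refine ciSup_le fun x => ?_
    by_cases hx : x ∈ Ω
    · have hux : u x ≤ dppOp α β ε u x + g x := by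
        refine le_of_tendsto' ((hlim x).comp (tendsto_add_atTop_nat 1)) fun l => ?_
        simp only [Function.comp_apply]
        rw [hrec l x hx]
        have := dppOp_mono (x := x) hε hα hβ.le hαβ (hmeas l) humeas (fun y _ => hbdd l y)
          (fun y _ => hub y) fun y _ => hle l y
        linarith
      have h1 := dppOp_le_add_average (x := x) (β := β) hε hα (fun y _ => hbdd k y)
        (fun y _ => hub y) fun y _ => hleM k y
      have h2 := mul_le_mul_of_nonneg_left (havg k x) hβ.le
      rw [hrec k x hx]
      linarith
    · rw [hout' _ x hx, sub_self]
      have := hM0 k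
      positivity
  have hMlim : Tendsto M atTop (nhds 0) :=
    tendsto_zero_of_le_mul_add (by linarith) hM0 hManti
      (by simpa using (hI0.const_mul c).const_mul β) hstep
  refine ⟨u, humeas, hub, ?_, fun x hx => ?_⟩
  · rw [Metric.tendstoUniformly_iff]
    intro δ hδ
    filter_upwards [hMlim.eventually_lt_const hδ] with k hk x
    rw [Real.dist_eq, abs_of_nonneg (sub_nonneg.2 (hle k x))]
    linarith [hleM k x]
  · have hsucc := (hlim x).comp (tendsto_add_atTop_nat 1)
    refine le_antisymm ?_ ?_
    · refine le_of_tendsto' hsucc fun k => ?_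
      have := dppOp_mono (x := x) hε hα hβ.le hαβ (hmeas k) humeas (fun y _ => hbdd k y)
        (fun y _ => hub y) fun y _ => hle k y
      simp only [Function.comp_apply, hrec k x hx]
      linarith
    · have hr : Tendsto (fun k => V (k + 1) x + M k) atTop (nhds (u x)) := by
        simpa using hsucc.add hMlim
      refine ge_of_tendsto' hr fun k => ?_
      have := dppOp_le_add (x := x) hε hα hβ.le hαβ (hmeas k) humeas (fun y _ => hbdd k y)
        (fun y _ => hub y) fun y _ => hleM k y
      simp only [hrec k x hx]
      linarith

/-- The iteration converges uniformly on `Ω_ε` to a bounded Borel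
measurable function satisfying the DPP. -/
theorem iteration_converges_to_dpp_solution
    (n : ℕ) (hn : 2 ≤ n) (Ω : Set (En n))
    (hΩopen : IsOpen Ω) (hΩbdd : Bornology.IsBounded Ω) (hΩconn : IsConnected Ω)
    (p : ℝ) (hp : 2 < p) (ε : ℝ) (hε : 0 < ε)
    (α β : ℝ) (hα : α = (p - 2) / (n + p)) (hβ : β = (n + 2) / (n + p))
    (F f : En n → ℝ)
    (hFmeas : Measurable F) (hFbdd : ∃ M, ∀ x ∈ bdryStrip n Ω ε, |F x| ≤ M)
    (hfmeas : Measurable f) (hfbdd : ∃ M, ∀ x ∈ Ω, |f x| ≤ M)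
    (hfpos : ∀ x ∈ Ω, 0 < f x)
    (U : ℕ → En n → ℝ)
    (hUbdry : ∀ k, Set.EqOn (U k) F (bdryStrip n Ω ε))
    (hU0 : ∀ x ∈ Ω, U 0 x = sInf (F '' bdryStrip n Ω ε))
    (hUrec : ∀ k, ∀ x ∈ Ω, U (k + 1) x =
      α / 2 * (sSup (U k '' Metric.ball x ε) + sInf (U k '' Metric.ball x ε))
        + β * (⨍ y in Metric.ball x ε, U k y) + ε ^ 2 * f x) :
    ∃ u : En n → ℝ, Measurable u ∧ (∃ M, ∀ x ∈ Ω ∪ bdryStrip n Ω ε, |u x| ≤ M) ∧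
      TendstoUniformlyOn (fun k => U k) u atTop (Ω ∪ bdryStrip n Ω ε) ∧
      SatisfiesDPP n α β ε Ω f u := by
  classical
  have hn0 : (0 : ℝ) < n := by exact_mod_cast (by omega : 0 < n)
  have hnp : 0 < (n : ℝ) + p := by linarith
  have hα0 : 0 < α := by rw [hα]; exact div_pos (by linarith) hnp
  have hβ0 : 0 < β := by rw [hβ]; exact div_pos (by linarith) hnp
  have hαβ : α + β = 1 := by rw [hα, hβ]; field_simp; ring
  obtain ⟨MF, hMF⟩ := hFbdd
  obtain ⟨Mf, hMf⟩ := hfbdd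
  set Γ := bdryStrip n Ω ε with hΓ
  have hΓm : MeasurableSet Γ := measurableSet_bdryStrip hΩopen ε
  have hball : ∀ x ∈ Ω, ball x ε ⊆ Ω ∪ Γ := fun x hx => ball_subset_union_bdryStrip hΩopen hx
  set m := sInf (F '' Γ) with hm
  have hmF : ∀ x ∈ Γ, m ≤ F x := fun x hx =>
    csInf_le (bddBelow_image_of_abs_le hMF) (mem_image_of_mem F hx)
  set V : ℕ → En n → ℝ := fun k => (Ω ∪ Γ).indicator (U k) with hV
  have hVΩΓ : ∀ k, EqOn (V k) (U k) (Ω ∪ Γ) := fun k x hx => indicator_of_mem hx _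
  have hVΓ : ∀ k, ∀ x ∈ Γ, V k x = F x := fun k x hx =>
    (hVΩΓ k (Or.inr hx)).trans (hUbdry k hx)
  have hVout : ∀ k, ∀ x ∉ Ω, V k x = Γ.indicator F x := by
    intro k x hx
    by_cases hxΓ : x ∈ Γ
    · rw [hVΓ k x hxΓ, indicator_of_mem hxΓ]
    · rw [indicator_of_notMem hxΓ]
      exact indicator_of_notMem (fun h => h.elim hx hxΓ) _
  have hV0 : ∀ x ∈ Ω, V 0 x = m := fun x hx => (hVΩΓ 0 (Or.inl hx)).trans (hU0 x hx)
  have hVrec : ∀ k, ∀ x ∈ Ω, V (k + 1) x = dppOp α β ε (V k) x + ε ^ 2 * f x := by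
    intro k x hx
    have himg : V k '' ball x ε = U k '' ball x ε := image_congr fun y hy =>
      hVΩΓ k (hball x hx hy)
    have havg : (⨍ y in ball x ε, V k y) = ⨍ y in ball x ε, U k y := by
      rw [setAverage_eq, setAverage_eq, setIntegral_congr_fun measurableSet_ball
        fun y hy => hVΩΓ k (hball x hx hy)]
    rw [hVΩΓ (k + 1) (Or.inl hx), hUrec k x hx, dppOp, himg, havg]
  have hout_le : ∀ x, |Γ.indicator F x| ≤ |MF| := fun x => by
    by_cases hx : x ∈ Γ
    · rw [indicator_of_mem hx]
      exact (hMF x hx).trans (le_abs_self _)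
    · rw [indicator_of_notMem hx, abs_zero]
      exact abs_nonneg _
  have hpiece : ∀ k, ∀ h : En n → ℝ, (∀ x ∈ Ω, V k x = h x) →
      V k = Ω.piecewise h (Γ.indicator F) := by
    intro k h hh
    funext x
    by_cases hx : x ∈ Ω
    · rw [piecewise_eq_of_mem _ _ _ hx, hh x hx]
    · rw [piecewise_eq_of_notMem _ _ _ hx, hVout k x hx]
  have hreg : ∀ k, Measurable (V k) ∧ ∃ C, ∀ x, |V k x| ≤ C := by
    intro k
    induction k with
    | zero =>
      rw [hpiece 0 (fun _ => m) hV0]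
      refine ⟨measurable_const.piecewise hΩopen.measurableSet (hFmeas.indicator hΓm),
        max |m| |MF|, fun x => ?_⟩
      by_cases hx : x ∈ Ω
      · rw [piecewise_eq_of_mem _ _ _ hx]
        exact le_max_left _ _
      · rw [piecewise_eq_of_notMem _ _ _ hx]
        exact (hout_le x).trans (le_max_right _ _)
    | succ k ih =>
      obtain ⟨hmk, C, hC⟩ := ih
      rw [hpiece (k + 1) (fun x => dppOp α β ε (V k) x + ε ^ 2 * f x) (hVrec k)]
      refine ⟨((measurable_dppOp α β hε hmk hC).add (hfmeas.const_mul _)).piecewise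
        hΩopen.measurableSet (hFmeas.indicator hΓm),
        max (C + ε ^ 2 * Mf) |MF|, fun x => ?_⟩
      by_cases hx : x ∈ Ω
      · rw [piecewise_eq_of_mem _ _ _ hx]
        refine (abs_add_le _ _).trans (le_trans (add_le_add ?_ ?_) (le_max_left _ _))
        · exact abs_dppOp_le hε hα0.le hβ0.le hαβ hmk fun y _ => hC y
        · rw [abs_mul, abs_of_pos (by positivity : 0 < ε ^ 2)]
          exact mul_le_mul_of_nonneg_left (hMf x hx) (by positivity)
      · rw [piecewise_eq_of_notMem _ _ _ hx]
        exact (hout_le x).trans (le_max_right _ _)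
  have hVm : ∀ k, Measurable (V k) := fun k => (hreg k).1
  choose C hC using fun k => (hreg k).2
  have hmV0 : ∀ x ∈ Ω ∪ Γ, m ≤ V 0 x := by
    rintro x (hx | hx)
    · exact (hV0 x hx).ge
    · exact (hmF x hx).trans (hVΓ 0 x hx).ge
  have hsucc : ∀ k x, V k x ≤ V (k + 1) x := by
    intro k
    induction k with
    | zero =>
      intro x
      by_cases hx : x ∈ Ω
      · rw [hV0 x hx, hVrec 0 x hx]
        have h1 : dppOp α β ε (fun _ => m) x ≤ dppOp α β ε (V 0) x :=
          dppOp_mono hε hα0.le hβ0.le hαβ measurable_const (hVm 0) (fun _ _ => le_rfl)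
            (fun y _ => hC 0 y) fun y hy => hmV0 y (hball x hx hy)
        rw [dppOp_const hε hαβ] at h1
        have := mul_pos (pow_pos hε 2) (hfpos x hx)
        linarith
      · rw [hVout _ x hx, hVout _ x hx]
    | succ k ih =>
      intro x
      by_cases hx : x ∈ Ω
      · rw [hVrec k x hx, hVrec (k + 1) x hx]
        have := dppOp_mono (x := x) hε hα0.le hβ0.le hαβ (hVm k) (hVm (k + 1))
          (fun y _ => hC k y) (fun y _ => hC (k + 1) y) fun y _ => ih y
        linarith
      · rw [hVout _ x hx, hVout _ x hx]
  have hVmono : Monotone V := monotone_nat_of_le_succ fun k x => hsucc k x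
  obtain ⟨R, hR, hΩR⟩ := hΩbdd.subset_closedBall_lt 0 (0 : En n)
  obtain ⟨v, A, hvc, hvA, hvK, hvT⟩ := exists_dppOp_supersolution (n := n) (by omega) hε hα0
    hβ0.le hαβ hR.le (by positivity : 0 ≤ ε ^ 2 * |Mf|) (max |m| |MF|)
  have hle_v : ∀ k, ∀ x ∈ closedBall (0 : En n) (R + ε), V k x ≤ v x := by
    have hout : ∀ k, ∀ x ∈ closedBall (0 : En n) (R + ε), x ∉ Ω → V k x ≤ v x :=
      fun k x hxR hx => by
        rw [hVout k x hx]
        exact (le_abs_self _).trans (((hout_le x).trans (le_max_right _ _)).trans (hvK x hxR))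
    intro k
    induction k with
    | zero =>
      intro x hxR
      by_cases hx : x ∈ Ω
      · rw [hV0 x hx]
        exact (le_abs_self _).trans ((le_max_left _ _).trans (hvK x hxR))
      · exact hout 0 x hxR hx
    | succ k ih =>
      intro x hxR
      by_cases hx : x ∈ Ω
      · have hsub : ball x ε ⊆ closedBall (0 : En n) (R + ε) := fun y hy => by
          have h1 := mem_ball.1 hy
          have h2 := mem_closedBall.1 (hΩR hx)
          exact mem_closedBall.2 ((dist_triangle y x 0).trans (by linarith))
        have h1 : dppOp α β ε (V k) x ≤ dppOp α β ε v x :=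
          dppOp_mono hε hα0.le hβ0.le hαβ (hVm k) hvc.measurable (fun y _ => hC k y)
            (C₂ := A) (fun y hy => abs_le.2
              ⟨by
                have h3 := hvK y (hsub hy)
                have h4 : 0 ≤ max |m| |MF| := (abs_nonneg m).trans (le_max_left _ _)
                linarith [hvA y], hvA y⟩) fun y hy => ih y (hsub hy)
        have h2 := hvT x (hΩR hx)
        have h3 : ε ^ 2 * f x ≤ ε ^ 2 * |Mf| := mul_le_mul_of_nonneg_left
          ((le_abs_self _).trans ((hMf x hx).trans (le_abs_self _))) (by positivity)
        rw [hVrec k x hx]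
        linarith
      · exact hout (k + 1) x hxR hx
  have hbound : ∀ k x, |V k x| ≤ max (max |m| |MF|) A := by
    intro k x
    by_cases hx : x ∈ Ω
    · have h1 : V 0 x ≤ V k x := hVmono (Nat.zero_le k) x
      rw [hV0 x hx] at h1
      refine abs_le.2 ⟨?_, ?_⟩
      · have h2 : |m| ≤ max (max |m| |MF|) A := (le_max_left _ _).trans (le_max_left _ _)
        linarith [neg_abs_le m]
      · exact ((hle_v k x (closedBall_subset_closedBall (by linarith) (hΩR hx))).trans
          (hvA x)).trans (le_max_right _ _)
    · rw [hVout k x hx]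
      exact (hout_le x).trans ((le_max_right _ _).trans (le_max_left _ _))
  obtain ⟨u, hum, hub, hulim, hudpp⟩ := exists_uniform_limit_of_monotone_iteration hΩopen hΩbdd
    hε hα0.le hβ0 hαβ hVm hbound hVmono (fun k x hx => by rw [hVout _ x hx, hVout _ x hx]) hVrec
  exact ⟨u, hum, ⟨_, fun x _ => hub x⟩,
    hulim.tendstoUniformlyOn.congr (.of_forall hVΩΓ), hudpp⟩
end
end

section
/- Control of the infimum: there is a constant C > 0 depending only on p and n with the following property. Let u : Ω_ε → ℝ be a bounded Borel measurable function with u > 0 on Ω_ε satisfying the DPP u(x) = (α/2)(sup_{B_ε(x)} u + inf_{B_ε(x)} u) + β ⨍_{B_ε(x)} u(y) dy + ε² f(x) for all x ∈ Ω, where f : Ω → ℝ is bounded Borel measurable with f > 0. If y ∈ Ω with B_{30}(y) ⊂ Ω, then for every z ∈ B_2(y) and every r ∈ (2ε, 1), inf_{B_r(z)} u ≤ C r^{−n} u(y). -/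
open MeasureTheory Metric Set Filter ProbabilityTheory

noncomputable section

open scoped RealInnerProductSpace Topology

/-- The second-order Taylor polynomial of `(1 + τ) ^ (-a)` at `0`, with a slightly smaller quadratic
coefficient, is a local lower bound. -/
lemma exists_quadratic_le_one_add_rpow_neg {a b : ℝ} (hb : 2 * b < a * (a + 1)) :
    ∃ δ > 0, ∀ τ : ℝ, |τ| < δ → 1 - a * τ + b * τ ^ 2 ≤ (1 + τ) ^ (-a) := by
  let G : ℝ → ℝ := fun τ => (1 + τ) ^ (-a) + a * τ - b * τ ^ 2
  have hG : ∀ τ : ℝ, -1 < τ →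
      HasDerivAt G (-a * (1 + τ) ^ (-a - 1) + a - 2 * b * τ) τ := by
    intro τ hτ
    have h1 : HasDerivAt (fun τ : ℝ => (1 + τ) ^ (-a)) (-a * (1 + τ) ^ (-a - 1) * 1) τ :=
      (Real.hasDerivAt_rpow_const (Or.inl (by linarith))).comp τ
        ((hasDerivAt_id τ).const_add 1)
    have h2 : HasDerivAt (fun τ : ℝ => a * τ) (a * 1) τ := (hasDerivAt_id τ).const_mul a
    have h3 : HasDerivAt (fun τ : ℝ => b * τ ^ 2) (b * (2 * τ)) τ := by
      simpa using (hasDerivAt_pow 2 τ).const_mul b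
    exact ((h1.add h2).sub h3).congr_deriv (by ring)
  have hev : deriv G =ᶠ[𝓝 0] fun τ => -a * (1 + τ) ^ (-a - 1) + a - 2 * b * τ := by
    filter_upwards [lt_mem_nhds (show (-1 : ℝ) < 0 by norm_num)] with τ hτ
    exact (hG τ hτ).deriv
  have hG2 : HasDerivAt (fun τ : ℝ => -a * (1 + τ) ^ (-a - 1) + a - 2 * b * τ)
      (a * (a + 1) - 2 * b) 0 := by
    have h1 : HasDerivAt (fun τ : ℝ => (1 + τ) ^ (-a - 1))
        ((-a - 1) * (1 + 0) ^ (-a - 1 - 1) * 1) 0 :=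
      (Real.hasDerivAt_rpow_const (Or.inl (by norm_num))).comp (0 : ℝ)
        ((hasDerivAt_id (0 : ℝ)).const_add 1)
    have h2 : HasDerivAt (fun τ : ℝ => 2 * b * τ) (2 * b * 1) 0 :=
      (hasDerivAt_id (0 : ℝ)).const_mul _
    refine (((h1.const_mul (-a)).add_const a).sub h2).congr_deriv ?_
    simp only [add_zero, Real.one_rpow]
    ring
  have hmin : IsLocalMin G 0 := by
    refine isLocalMin_of_deriv_deriv_pos ?_ ?_ (hG 0 (by norm_num)).continuousAt
    · rw [hev.deriv_eq, hG2.deriv]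
      linarith
    · rw [(hG 0 (by norm_num)).deriv]
      simp
  obtain ⟨δ, hδ, h⟩ := Metric.eventually_nhds_iff.1 hmin
  refine ⟨δ, hδ, fun τ hτ => ?_⟩
  have := h (y := τ) (by simpa [Real.dist_eq] using hτ)
  simp only [G, add_zero, Real.one_rpow, mul_zero] at this
  linarith

/-- Pointwise quadratic lower bound for the radial function `‖·‖ ^ (-n)` near a point that is far
from the origin relative to the increment. -/
lemma exists_quadratic_le_inv_norm_pow {E : Type*} [NormedAddCommGroup E] [InnerProductSpace ℝ E]
    {n : ℕ} (hn : 1 ≤ n) :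
    ∃ K > (0 : ℝ), ∀ v h : E, v ≠ 0 → K * ‖h‖ ≤ ‖v‖ →
      (‖v‖ ^ n)⁻¹ * (1 - n / 2 * ((2 * ⟪v, h⟫ + ‖h‖ ^ 2) / ‖v‖ ^ 2)
        + (n ^ 2 + n) / 8 * (4 * (⟪v, h⟫ ^ 2 + ⟪v, h⟫ * ‖h‖ ^ 2) / ‖v‖ ^ 4))
        ≤ (‖v + h‖ ^ n)⁻¹ := by
  have hn' : (1 : ℝ) ≤ n := by exact_mod_cast hn
  obtain ⟨δ, hδ, H⟩ := exists_quadratic_le_one_add_rpow_neg (a := (n : ℝ) / 2)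
    (b := ((n : ℝ) ^ 2 + n) / 8) (by nlinarith)
  refine ⟨1 + 4 / δ, by positivity, fun v h hv hK => ?_⟩
  have hv' : 0 < ‖v‖ := norm_pos_iff.2 hv
  set t : ℝ := (2 * ⟪v, h⟫ + ‖h‖ ^ 2) / ‖v‖ ^ 2 with ht
  have hhv : ‖h‖ ≤ ‖v‖ := by
    have : 0 ≤ 4 / δ * ‖h‖ := by positivity
    linarith
  have hhd : 4 * ‖h‖ < δ * ‖v‖ ∨ h = 0 := by
    by_cases h0 : h = 0
    · exact Or.inr h0
    · left
      have hh : 0 < ‖h‖ := norm_pos_iff.2 h0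
      have : 4 / δ * ‖h‖ < ‖v‖ := by linarith
      have h2 := mul_lt_mul_of_pos_left this hδ
      have h3 : δ * (4 / δ * ‖h‖) = 4 * ‖h‖ := by field_simp
      linarith
  have hin := abs_real_inner_le_norm v h
  have htd : |t| < δ := by
    rw [ht, abs_div, abs_of_pos (a := ‖v‖ ^ 2) (by positivity), div_lt_iff₀ (by positivity)]
    rcases hhd with hd | rfl
    · have h1 : |2 * ⟪v, h⟫ + ‖h‖ ^ 2| ≤ 2 * (‖v‖ * ‖h‖) + ‖h‖ ^ 2 := by
        refine (abs_add_le _ _).trans ?_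
        rw [abs_mul, abs_two, abs_of_nonneg (sq_nonneg ‖h‖)]
        linarith
      nlinarith [norm_nonneg h]
    · simp
      positivity
  have hq : 1 + t = (‖v + h‖ / ‖v‖) ^ 2 := by
    rw [div_pow, norm_add_sq_real, ht]
    field_simp
    ring
  have hpow : (1 + t) ^ (-((n : ℝ) / 2)) = ‖v‖ ^ n * (‖v + h‖ ^ n)⁻¹ := by
    have hs : 0 ≤ ‖v + h‖ / ‖v‖ := by positivity
    rw [hq, Real.rpow_neg (by positivity), ← Real.rpow_natCast (_ / _) 2, ← Real.rpow_mul hs]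
    rw [show ((2 : ℕ) : ℝ) * ((n : ℝ) / 2) = (n : ℝ) by push_cast; ring, Real.rpow_natCast, div_pow,
      inv_div, div_eq_mul_inv]
  have hT := H t htd
  rw [hpow] at hT
  have hsq : 4 * (⟪v, h⟫ ^ 2 + ⟪v, h⟫ * ‖h‖ ^ 2) / ‖v‖ ^ 4 ≤ t ^ 2 := by
    rw [ht, div_pow, ← pow_mul]
    gcongr
    nlinarith [sq_nonneg (‖h‖ ^ 2)]
  calc _ ≤ (‖v‖ ^ n)⁻¹ * (1 - n / 2 * t + (n ^ 2 + n) / 8 * t ^ 2) := by gcongr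
    _ ≤ (‖v‖ ^ n)⁻¹ * (‖v‖ ^ n * (‖v + h‖ ^ n)⁻¹) := by gcongr
    _ = _ := by field_simp

lemma integrableOn_ball_of_continuous {n : ℕ} {g : En n → ℝ} (hg : Continuous g) (x : En n)
    (ε : ℝ) : IntegrableOn g (ball x ε) :=
  (hg.continuousOn.integrableOn_compact (isCompact_closedBall x ε)).mono_set ball_subset_closedBall

/-- Integrals over centred balls are invariant under linear isometries. -/
lemma setIntegral_ball_comp_linearIsometryEquiv {n : ℕ} (L : En n ≃ₗᵢ[ℝ] En n) (g : En n → ℝ)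
    (ε : ℝ) : ∫ h in ball (0 : En n) ε, g (L h) = ∫ h in ball (0 : En n) ε, g h := by
  have := L.measurePreserving.setIntegral_preimage_emb
    L.toHomeomorph.measurableEmbedding g (ball 0 ε)
  rwa [L.preimage_ball, map_zero] at this

lemma setIntegral_ball_eq_zero_of_odd {n : ℕ} {g : En n → ℝ} (hg : ∀ h, g (-h) = -g h) (ε : ℝ) :
    ∫ h in ball (0 : En n) ε, g h = 0 := by
  have := setIntegral_ball_comp_linearIsometryEquiv (LinearIsometryEquiv.neg ℝ) g ε
  simp only [LinearIsometryEquiv.coe_neg, hg, integral_neg] at this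
  linarith

lemma setIntegral_ball_inner_sq {n : ℕ} (v : En n) (ε : ℝ) :
    n * ∫ h in ball (0 : En n) ε, ⟪v, h⟫ ^ 2 = ‖v‖ ^ 2 * ∫ h in ball (0 : En n) ε, ‖h‖ ^ 2 := by
  let e := EuclideanSpace.basisFun (Fin n) ℝ
  have hrot : ∀ i, ∫ h in ball (0 : En n) ε, ⟪v, h⟫ ^ 2
      = ‖v‖ ^ 2 * ∫ h in ball (0 : En n) ε, ⟪e i, h⟫ ^ 2 := by
    intro i
    have hnorm : ‖‖v‖ • e i‖ = ‖v‖ := by simp [norm_smul, e.orthonormal.1 i]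
    let L := (Submodule.span ℝ {‖v‖ • e i - v})ᗮ.reflection
    have hL : L (‖v‖ • e i) = v := Submodule.reflection_sub hnorm
    rw [← setIntegral_ball_comp_linearIsometryEquiv L, ← integral_const_mul]
    congr 1 with h
    rw [← hL, L.inner_map_map, real_inner_smul_left, mul_pow, hL]
  have hsum : ∑ i, ∫ h in ball (0 : En n) ε, ⟪e i, h⟫ ^ 2 = ∫ h in ball (0 : En n) ε, ‖h‖ ^ 2 := by
    rw [← integral_finsetSum]
    · congr 1 with h
      rw [← e.sum_sq_norm_inner_right h]
      simp
    · intro i _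
      exact integrableOn_ball_of_continuous (by fun_prop) _ _
  rw [← hsum, Finset.mul_sum, ← Finset.sum_congr rfl fun i _ => hrot i]
  simp

lemma setIntegral_ball_quadratic {n : ℕ} (hn : 1 ≤ n) (v : En n) (ε c l k p q : ℝ) :
    ∫ h in ball (0 : En n) ε,
        (c + (l * ⟪v, h⟫ + k * (⟪v, h⟫ * ‖h‖ ^ 2)) + p * ‖h‖ ^ 2 + q * ⟪v, h⟫ ^ 2)
      = volume.real (ball (0 : En n) ε) * c
        + (p + q * ‖v‖ ^ 2 / n) * ∫ h in ball (0 : En n) ε, ‖h‖ ^ 2 := by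
  have hn0 : (n : ℝ) ≠ 0 := by positivity
  have hodd : ∫ h in ball (0 : En n) ε, (l * ⟪v, h⟫ + k * (⟪v, h⟫ * ‖h‖ ^ 2)) = 0 :=
    setIntegral_ball_eq_zero_of_odd (fun h => by simp only [inner_neg_right, norm_neg]; ring) ε
  have hsq := setIntegral_ball_inner_sq v ε
  rw [integral_add, integral_add, integral_add, hodd, integral_const_mul, integral_const_mul,
    setIntegral_const, smul_eq_mul, eq_div_of_mul_eq hn0 ((mul_comm _ _).trans hsq)]
  · ring
  all_goals exact integrableOn_ball_of_continuous (by fun_prop) _ _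

/-- Translated, scaled and shifted copies of `‖·‖ ^ (-n)` are strictly submean on balls that are
small compared with the distance to the pole. -/
lemma exists_barrier_le_setAverage {n : ℕ} (hn : 1 ≤ n) :
    ∃ K > (0 : ℝ), ∀ (ε : ℝ) (x z : En n) (M μ : ℝ) (u : En n → ℝ), 0 < ε → 0 ≤ M →
      K * ε ≤ ‖x - z‖ → IntegrableOn u (ball x ε) →
      (∀ y ∈ ball x ε, M * (‖y - z‖ ^ n)⁻¹ + μ ≤ u y) →
      M * (‖x - z‖ ^ n)⁻¹ * (1 + (⨍ h in ball (0 : En n) ε, ‖h‖ ^ 2) / (2 * ‖x - z‖ ^ 2)) + μ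
        ≤ ⨍ y in ball x ε, u y := by
  obtain ⟨K, hK, H⟩ := exists_quadratic_le_inv_norm_pow (E := En n) hn
  refine ⟨K, hK, fun ε x z M μ u hε hM hx hu hle => ?_⟩
  have hn0 : (n : ℝ) ≠ 0 := by positivity
  set v := x - z with hv
  have hvpos : 0 < ‖v‖ := lt_of_lt_of_le (by positivity) hx
  set N := M * (‖v‖ ^ n)⁻¹ with hN
  have hvol : 0 < volume.real (ball (0 : En n) ε) :=
    ENNReal.toReal_pos (measure_ball_pos _ _ hε).ne' measure_ball_lt_top.ne
  have hvolx : volume.real (ball x ε) = volume.real (ball (0 : En n) ε) := by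
    simp only [measureReal_def, Measure.addHaar_ball_center]
  have hpre : (fun h => x + h) ⁻¹' ball x ε = ball 0 ε := by
    ext h; simp [mem_ball, dist_eq_norm]
  have hmp := measurePreserving_add_left (volume : Measure (En n)) x
  have hemb : MeasurableEmbedding (fun h : En n => x + h) := measurableEmbedding_addLeft x
  have htrans : ∫ y in ball x ε, u y = ∫ h in ball (0 : En n) ε, u (x + h) := by
    rw [← hmp.setIntegral_preimage_emb hemb u, hpre]
  have hint : IntegrableOn (fun h => u (x + h)) (ball 0 ε) := by
    rw [← hpre]
    exact (hmp.integrableOn_comp_preimage hemb).2 hu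
  have hlow : ∫ h in ball (0 : En n) ε,
      ((N + μ) + ((-(N * n / ‖v‖ ^ 2)) * ⟪v, h⟫
          + (N * (n ^ 2 + n) / (2 * ‖v‖ ^ 4)) * (⟪v, h⟫ * ‖h‖ ^ 2))
        + (-(N * n / (2 * ‖v‖ ^ 2))) * ‖h‖ ^ 2
        + (N * (n ^ 2 + n) / (2 * ‖v‖ ^ 4)) * ⟪v, h⟫ ^ 2)
      ≤ ∫ h in ball (0 : En n) ε, u (x + h) := by
    refine setIntegral_mono_on (integrableOn_ball_of_continuous (by fun_prop) _ _) hint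
      measurableSet_ball fun h hh => ?_
    have hh' : ‖h‖ < ε := by simpa using hh
    have h1 := H v h (norm_pos_iff.1 hvpos) ((mul_le_mul_of_nonneg_left hh'.le hK.le).trans hx)
    have h2 := hle (x + h) (by simpa [dist_eq_norm] using hh')
    have h3 : x + h - z = v + h := by rw [hv]; abel
    rw [h3] at h2
    refine le_trans (le_of_eq ?_) ((add_le_add_left (mul_le_mul_of_nonneg_left h1 hM) μ).trans h2)
    rw [hN]
    field_simp
    ring
  rw [setIntegral_ball_quadratic hn] at hlow
  rw [setAverage_eq, setAverage_eq, hvolx, htrans, smul_eq_mul, smul_eq_mul, le_inv_mul_iff₀ hvol]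
  refine le_trans (le_of_eq ?_) hlow
  set V := volume.real (ball (0 : En n) ε)
  set I := ∫ h in ball (0 : En n) ε, ‖h‖ ^ 2
  field_simp
  ring

lemma setAverage_ball_norm_sq_pos {n : ℕ} (hn : 1 ≤ n) {ε : ℝ} (hε : 0 < ε) :
    0 < ⨍ h in ball (0 : En n) ε, ‖h‖ ^ 2 := by
  have hvol : 0 < volume.real (ball (0 : En n) ε) :=
    ENNReal.toReal_pos (measure_ball_pos _ _ hε).ne' measure_ball_lt_top.ne
  have : Nonempty (Fin n) := ⟨⟨0, hn⟩⟩
  rw [setAverage_eq, smul_eq_mul]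
  refine mul_pos (inv_pos.2 hvol) ?_
  rw [setIntegral_pos_iff_support_of_nonneg_ae (ae_of_all _ fun h => by positivity)
    (integrableOn_ball_of_continuous (by fun_prop) _ _)]
  have : Function.support (fun h : En n => ‖h‖ ^ 2) = {0}ᶜ := by
    ext h; simp
  rw [this, inter_comm, ← sdiff_eq, measure_sdiff_null (measure_singleton _)]
  exact measure_ball_pos _ _ hε

lemma two_mul_inv_pow_le_add (n : ℕ) {ρ s : ℝ} (hs : 0 ≤ s) (hρ : s < ρ) :
    2 * (ρ ^ n)⁻¹ ≤ ((ρ - s) ^ n)⁻¹ + ((ρ + s) ^ n)⁻¹ := by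
  obtain ⟨-, hconv⟩ := convexOn_zpow (𝕜 := ℝ) (-(n : ℤ))
  have h := hconv (x := ρ - s) (mem_Ioi.2 (by linarith)) (y := ρ + s) (mem_Ioi.2 (by linarith))
    (a := 1 / 2) (b := 1 / 2) (by norm_num) (by norm_num) (by norm_num)
  simp only [smul_eq_mul, zpow_neg, zpow_natCast] at h
  rw [show 1 / 2 * (ρ - s) + 1 / 2 * (ρ + s) = ρ by ring] at h
  linarith

/-- The point at distance `s` from `x` on the segment from `x` towards `z`. -/
lemma exists_dist_eq_sub {n : ℕ} {x z : En n} {s : ℝ} (hs : 0 ≤ s) (hsx : s < ‖x - z‖) :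
    ∃ w, dist w x = s ∧ ‖w - z‖ = ‖x - z‖ - s := by
  have hρ : 0 < ‖x - z‖ := hs.trans_lt hsx
  refine ⟨x - (s / ‖x - z‖) • (x - z), ?_, ?_⟩
  · rw [dist_eq_norm, sub_sub_cancel_left, norm_neg, norm_smul, Real.norm_of_nonneg (by positivity)]
    field_simp
  · have h1 : 0 ≤ 1 - s / ‖x - z‖ := by
      rw [sub_nonneg, div_le_one hρ]
      exact hsx.le
    have h2 : x - (s / ‖x - z‖) • (x - z) - z = (1 - s / ‖x - z‖) • (x - z) := by
      rw [sub_smul, one_smul]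
      abel
    rw [h2, norm_smul, Real.norm_of_nonneg h1]
    field_simp

/-- If `u` lies above a radial barrier on `B_ε(x)`, then so does its midrange, evaluated at `x`. -/
lemma two_mul_barrier_le_sSup_add_sInf {n : ℕ} {ε : ℝ} {x z : En n} {M μ B : ℝ} {u : En n → ℝ}
    (hε : 0 < ε) (hM : 0 ≤ M) (hx : ε < ‖x - z‖) (hB : ∀ y ∈ ball x ε, u y ≤ B)
    (hle : ∀ y ∈ ball x ε, M * (‖y - z‖ ^ n)⁻¹ + μ ≤ u y) :
    2 * (M * (‖x - z‖ ^ n)⁻¹ + μ) ≤ sSup (u '' ball x ε) + sInf (u '' ball x ε) := by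
  set ρ := ‖x - z‖ with hρ
  have hbdd : BddAbove (u '' ball x ε) := ⟨B, by rintro _ ⟨y, hy, rfl⟩; exact hB y hy⟩
  have hinf : M * ((ρ + ε) ^ n)⁻¹ + μ ≤ sInf (u '' ball x ε) := by
    refine le_csInf ((nonempty_ball.2 hε).image u) ?_
    rintro _ ⟨y, hy, rfl⟩
    refine le_trans ?_ (hle y hy)
    have hyx : ‖y - x‖ < ε := by rwa [← dist_eq_norm]
    have h1 : ‖y - z‖ ≤ ρ + ε := by
      have := norm_add_le (y - x) (x - z)
      rw [sub_add_sub_cancel] at this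
      linarith
    have h2 : 0 < ‖y - z‖ := by
      have := norm_sub_norm_le (x - z) (x - y)
      rw [sub_sub_sub_cancel_left, norm_sub_rev x y] at this
      linarith
    gcongr
  have hsup : M * ((ρ - ε) ^ n)⁻¹ + μ ≤ sSup (u '' ball x ε) := by
    have ht : Tendsto (fun s : ℝ => M * ((ρ - s) ^ n)⁻¹ + μ) (𝓝[<] ε)
        (𝓝 (M * ((ρ - ε) ^ n)⁻¹ + μ)) := by
      have hne : (ρ - ε) ^ n ≠ 0 := pow_ne_zero _ (by linarith)
      have : ContinuousAt (fun s : ℝ => M * ((ρ - s) ^ n)⁻¹ + μ) ε := by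
        fun_prop (disch := assumption)
      exact this.tendsto.mono_left nhdsWithin_le_nhds
    refine le_of_tendsto ht ?_
    filter_upwards [Ioo_mem_nhdsLT hε] with s hs
    obtain ⟨w, hwx, hwz⟩ := exists_dist_eq_sub (x := x) (z := z) hs.1.le (hs.2.trans hx)
    have hw : w ∈ ball x ε := by rw [mem_ball, hwx]; exact hs.2
    have := hle w hw
    rw [hwz] at this
    exact this.trans (le_csSup hbdd (mem_image_of_mem u hw))
  have := mul_le_mul_of_nonneg_left (two_mul_inv_pow_le_add n hε.le hx) hM
  linarith

/-- A nonnegative supersolution loses at most a factor `α / 2` over one step. -/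
lemma half_mul_le_of_mem_ball {n : ℕ} {α β ε B : ℝ} {u : En n → ℝ} {x w : En n}
    (hα : 0 ≤ α) (hβ : 0 ≤ β) (hB : ∀ y ∈ ball x ε, u y ≤ B) (hpos : ∀ y ∈ ball x ε, 0 < u y)
    (hsuper : α / 2 * (sSup (u '' ball x ε) + sInf (u '' ball x ε))
      + β * (⨍ y in ball x ε, u y) ≤ u x) (hw : w ∈ ball x ε) :
    α / 2 * u w ≤ u x := by
  have hbdd : BddAbove (u '' ball x ε) := ⟨B, by rintro _ ⟨y, hy, rfl⟩; exact hB y hy⟩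
  have h1 : u w ≤ sSup (u '' ball x ε) := le_csSup hbdd (mem_image_of_mem u hw)
  have h2 : 0 ≤ sInf (u '' ball x ε) :=
    Real.sInf_nonneg (by rintro _ ⟨y, hy, rfl⟩; exact (hpos y hy).le)
  have h3 : 0 ≤ ⨍ y in ball x ε, u y := by
    rw [setAverage_eq]
    exact smul_nonneg (by positivity)
      (setIntegral_nonneg measurableSet_ball fun y hy => (hpos y hy).le)
  have h4 : α / 2 * u w ≤ α / 2 * (sSup (u '' ball x ε) + sInf (u '' ball x ε)) := by
    gcongr
    linarith
  have h5 := mul_nonneg hβ h3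
  linarith

/-- Iterating the one-step bound propagates a lower bound from `B_r(z)` to `B_{r + kε/2}(z)`. -/
lemma pow_mul_le_of_lt_add {n : ℕ} {α ε r R m : ℝ} {u : En n → ℝ} {z : En n}
    (hα : 0 ≤ α) (hα1 : α ≤ 1) (hε : 0 < ε) (hr : 2 * ε < r) (hm : 0 ≤ m)
    (hstep : ∀ x ∈ ball z R, ∀ w ∈ ball x ε, α / 2 * u w ≤ u x)
    (hmr : ∀ x ∈ ball z r, m ≤ u x) (k : ℕ) :
    ∀ x ∈ ball z R, ‖x - z‖ < r + k * (ε / 2) → (α / 2) ^ k * m ≤ u x := by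
  induction k with
  | zero =>
    intro x _ hxr
    simpa using hmr x (by simpa [dist_eq_norm] using hxr)
  | succ k ih =>
    intro x hxR hxr
    by_cases hx : ‖x - z‖ < r + k * (ε / 2)
    · refine le_trans ?_ (ih x hxR hx)
      gcongr ?_ * m
      exact pow_le_pow_of_le_one (by linarith) (by linarith) k.le_succ
    · have hk : 0 ≤ k * (ε / 2) := by positivity
      obtain ⟨w, hwx, hwz⟩ := exists_dist_eq_sub (x := x) (z := z) (s := ε / 2) (by linarith)
        (by linarith)
      push_cast at hxr
      have hw := ih w (by
        rw [mem_ball, dist_eq_norm] at hxR ⊢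
        linarith) (by linarith)
      calc (α / 2) ^ (k + 1) * m = α / 2 * ((α / 2) ^ k * m) := by ring
        _ ≤ α / 2 * u w := by gcongr
        _ ≤ u x := hstep x hxR w (by rw [mem_ball, hwx]; linarith)

/-- Comparison of a positive supersolution on `B_R(z)` with a radial barrier. -/
lemma exists_barrier_comparison {n : ℕ} (hn : 1 ≤ n) {α β : ℝ} (hα : 0 ≤ α) (hβ : 0 < β)
    (hαβ : α + β = 1) :
    ∃ K > (0 : ℝ), ∀ (ε ρ R m B : ℝ) (z : En n) (u : En n → ℝ), 0 < ε → 2 * ε < ρ → ρ < R →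
      K * ε ≤ ρ → 0 < m → Measurable u → (∀ x ∈ ball z (R + ε), 0 < u x ∧ u x ≤ B) →
      (∀ x ∈ ball z R, α / 2 * (sSup (u '' ball x ε) + sInf (u '' ball x ε))
        + β * (⨍ y in ball x ε, u y) ≤ u x) →
      (∀ x ∈ ball z ρ, m ≤ u x) →
      ∀ x ∈ ball z R, ρ ≤ ‖x - z‖ →
        m * (ρ / 2) ^ n * ((‖x - z‖ ^ n)⁻¹ - (R ^ n)⁻¹) ≤ u x := by
  obtain ⟨K, hK, H⟩ := exists_barrier_le_setAverage hn
  refine ⟨K, hK, fun ε ρ R m B z u hε hερ hρR hKρ hm hu hpB hsuper hmρ x₀ hx₀ hx₀ρ => ?_⟩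
  have hρ : 0 < ρ := by linarith
  have hR : 0 < R := by linarith
  set M := m * (ρ / 2) ^ n with hMdef
  have hM : 0 < M := by positivity
  set A := ⨍ h in ball (0 : En n) ε, ‖h‖ ^ 2 with hA
  have hApos : 0 < A := setAverage_ball_norm_sq_pos hn hε
  set γ := β * (M * (R ^ n)⁻¹ * (A / (2 * R ^ 2))) with hγ
  have hγpos : 0 < γ := by positivity
  let N : Set (En n) := {x | ρ / 2 ≤ ‖x - z‖ ∧ ‖x - z‖ < R + ε}
  let w : En n → ℝ := fun x => u x - M * (‖x - z‖ ^ n)⁻¹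
  have hψ : ∀ x ∈ N, M * (‖x - z‖ ^ n)⁻¹ ≤ m := by
    intro x hx
    rw [← div_eq_mul_inv, div_le_iff₀ (pow_pos (by linarith [hx.1]) n)]
    have := hx.1
    rw [hMdef]
    gcongr
  have hNpos : ∀ x ∈ N, 0 < u x ∧ u x ≤ B := fun x hx =>
    hpB x (by rw [mem_ball, dist_eq_norm]; exact hx.2)
  have hbelow : BddBelow (w '' N) := by
    refine ⟨-m, ?_⟩
    rintro _ ⟨x, hx, rfl⟩
    have h1 := (hNpos x hx).1
    have h2 := hψ x hx
    simp only [w]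
    linarith
  by_contra! hcon
  rw [mem_ball, dist_eq_norm] at hx₀
  have hx₀N : x₀ ∈ N := ⟨by linarith, by linarith⟩
  set μ := sInf (w '' N) with hμ
  have hμlt : μ < -(M * (R ^ n)⁻¹) := by
    refine (csInf_le hbelow (mem_image_of_mem w hx₀N)).trans_lt ?_
    simp only [w]
    linarith
  obtain ⟨_, ⟨x, hx, rfl⟩, hxw⟩ := exists_lt_of_csInf_lt (⟨_, mem_image_of_mem w hx₀N⟩)
    (lt_min hμlt (lt_add_of_pos_right μ hγpos))
  obtain ⟨hx1, hx2⟩ := lt_min_iff.1 hxw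
  simp only [w] at hx1 hx2
  rcases lt_or_ge ‖x - z‖ ρ with hxρ | hxρ
  · have h1 := hmρ x (by rwa [mem_ball, dist_eq_norm])
    have h2 := hψ x hx
    have h3 : 0 < M * (R ^ n)⁻¹ := by positivity
    linarith
  rcases le_or_gt R ‖x - z‖ with hxR | hxR
  · have h1 := (hNpos x hx).1
    have h2 : M * (‖x - z‖ ^ n)⁻¹ ≤ M * (R ^ n)⁻¹ := by gcongr
    linarith
  have hball : ball x ε ⊆ N := by
    intro y hy
    have hyx : ‖y - x‖ < ε := by rwa [← dist_eq_norm]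
    have h1 := norm_add_le (y - x) (x - z)
    have h2 := norm_sub_norm_le (x - z) (x - y)
    rw [sub_sub_sub_cancel_left, norm_sub_rev x y] at h2
    rw [sub_add_sub_cancel] at h1
    exact ⟨by linarith, by linarith⟩
  have hle : ∀ y ∈ ball x ε, M * (‖y - z‖ ^ n)⁻¹ + μ ≤ u y := by
    intro y hy
    have := csInf_le hbelow (mem_image_of_mem w (hball hy))
    simp only [w] at this
    linarith
  have hint : IntegrableOn u (ball x ε) := by
    refine Measure.integrableOn_of_bounded measure_ball_lt_top.ne hu.aestronglyMeasurable (M := B) ?_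
    filter_upwards [ae_restrict_mem measurableSet_ball] with y hy
    obtain ⟨h1, h2⟩ := hNpos y (hball hy)
    rwa [Real.norm_of_nonneg h1.le]
  have hmid := two_mul_barrier_le_sSup_add_sInf hε hM.le (by linarith)
    (fun y hy => (hNpos y (hball hy)).2) hle
  have havg := H ε x z M μ u hε hM.le (hKρ.trans hxρ) hint hle
  have hs := hsuper x (by rwa [mem_ball, dist_eq_norm])
  have hxpos : 0 < ‖x - z‖ := by linarith
  have hgain : γ ≤ β * (M * (‖x - z‖ ^ n)⁻¹ * (A / (2 * ‖x - z‖ ^ 2))) := by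
    rw [hγ]
    gcongr
  have h1 := mul_le_mul_of_nonneg_left hmid (show 0 ≤ α / 2 by linarith)
  have h2 := mul_le_mul_of_nonneg_left havg hβ.le
  have hsplit : α / 2 * (2 * (M * (‖x - z‖ ^ n)⁻¹ + μ))
      + β * (M * (‖x - z‖ ^ n)⁻¹ * (1 + A / (2 * ‖x - z‖ ^ 2)) + μ)
      = M * (‖x - z‖ ^ n)⁻¹ + μ + β * (M * (‖x - z‖ ^ n)⁻¹ * (A / (2 * ‖x - z‖ ^ 2))) := by
    linear_combination (M * (‖x - z‖ ^ n)⁻¹ + μ) * hαβ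
  linarith

/-- Lemma 3.5, normalized case `R = 1`. Control of the infimum: there
is `C = C(p, n) > 0` such that if `u > 0` is a positive bounded Borel DPP solution and
`B_30(y) ⊆ Ω`, then `inf_{B_r(z)} u ≤ C r^{−n} u(y)` for `z ∈ B_2(y)` and `r ∈ (2ε, 1)`. -/
theorem control_of_infimum
    (n : ℕ) (hn : 2 ≤ n) (p : ℝ) (hp : 2 < p)
    (α β : ℝ) (hα : α = (p - 2) / (n + p)) (hβ : β = (n + 2) / (n + p)) :
    ∃ C > (0 : ℝ), ∀ (Ω : Set (En n)),
      IsOpen Ω → Bornology.IsBounded Ω → IsConnected Ω →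
      ∀ ε : ℝ, 0 < ε →
      ∀ f : En n → ℝ, Measurable f → (∃ M, ∀ x ∈ Ω, |f x| ≤ M) → (∀ x ∈ Ω, 0 < f x) →
      ∀ u : En n → ℝ, Measurable u → (∃ M, ∀ x ∈ Ω ∪ bdryStrip n Ω ε, |u x| ≤ M) →
        (∀ x ∈ Ω ∪ bdryStrip n Ω ε, 0 < u x) → SatisfiesDPP n α β ε Ω f u →
      ∀ y : En n, Metric.ball y 30 ⊆ Ω →
      ∀ z ∈ Metric.ball y 2, ∀ r : ℝ, 2 * ε < r → r < 1 →
        sInf (u '' Metric.ball z r) ≤ C * r ^ (-(n : ℝ)) * u y := by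
  have hn1 : 1 ≤ n := by omega
  have hden : (0 : ℝ) < n + p := by positivity
  have hα0 : 0 < α := hα ▸ div_pos (by linarith) hden
  have hβ0 : 0 < β := hβ ▸ div_pos (by positivity) hden
  have hαβ : α + β = 1 := by
    rw [hα, hβ, ← add_div, div_eq_one_iff_eq hden.ne']
    ring
  obtain ⟨K, hK, hcomp⟩ := exists_barrier_comparison hn1 hα0.le hβ0 hαβ
  obtain ⟨k, hk⟩ := exists_nat_ge (2 * K)
  set c := (α / 2) ^ k with hc
  have hcpos : 0 < c := by positivity
  set g : ℝ := (2 ^ n)⁻¹ - (5 ^ n)⁻¹ with hg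
  have hgpos : 0 < g := by
    rw [hg, sub_pos]
    gcongr
    norm_num
  have hg1 : g ≤ 1 := by
    have h1 : ((2 : ℝ) ^ n)⁻¹ ≤ 1 := inv_le_one_of_one_le₀ (one_le_pow₀ (by norm_num))
    have h2 : (0 : ℝ) < (5 ^ n)⁻¹ := by positivity
    linarith
  refine ⟨2 ^ n / (c * g), by positivity, ?_⟩
  intro Ω _ _ _ ε hε f _ _ hf u hu hM hpos hdpp y hy z hz r hr hr1
  obtain ⟨B, hB⟩ := hM
  have hrpos : 0 < r := by linarith
  have hzy : ‖y - z‖ < 2 := by rwa [← dist_eq_norm, ← mem_ball']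
  have hsub : ball z (5 + ε) ⊆ Ω := by
    refine (ball_subset_ball' ?_).trans hy
    rw [dist_comm, dist_eq_norm]
    linarith
  have hpB : ∀ x ∈ ball z (5 + ε), 0 < u x ∧ u x ≤ B := fun x hx =>
    ⟨hpos x (Or.inl (hsub hx)), (le_abs_self _).trans (hB x (Or.inl (hsub hx)))⟩
  have hsuper : ∀ x ∈ ball z 5, α / 2 * (sSup (u '' ball x ε) + sInf (u '' ball x ε))
      + β * (⨍ y in ball x ε, u y) ≤ u x := by
    intro x hx
    have hxΩ := hsub (ball_subset_ball (by linarith) hx)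
    rw [hdpp x hxΩ]
    have := mul_pos (pow_pos hε 2) (hf x hxΩ)
    linarith
  have hstep : ∀ x ∈ ball z 5, ∀ w ∈ ball x ε, α / 2 * u w ≤ u x := by
    intro x hx w hw
    have hxs : ball x ε ⊆ ball z (5 + ε) :=
      ball_subset_ball' (by rw [mem_ball] at hx; linarith)
    exact half_mul_le_of_mem_ball hα0.le hβ0.le (fun v hv => (hpB v (hxs hv)).2)
      (fun v hv => (hpB v (hxs hv)).1) (hsuper x hx) hw
  have hrs : ball z r ⊆ ball z (5 + ε) := ball_subset_ball (by linarith)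
  have hnonneg : ∀ t ∈ u '' ball z r, 0 ≤ t := by
    rintro _ ⟨x, hx, rfl⟩
    exact (hpB x (hrs hx)).1.le
  set m := sInf (u '' ball z r) with hm
  have hm0 : 0 ≤ m := Real.sInf_nonneg hnonneg
  have hmr : ∀ x ∈ ball z r, m ≤ u x := fun x hx => csInf_le ⟨0, hnonneg⟩ (mem_image_of_mem u hx)
  have hiter := pow_mul_le_of_lt_add hα0.le (by linarith) hε hr hm0 hstep hmr k
  have hy5 : y ∈ ball z 5 := by
    rw [mem_ball, dist_eq_norm]
    linarith
  have hkε : 0 ≤ k * (ε / 2) := by positivity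
  have key : c * m * (r / 2) ^ n * g ≤ u y := by
    rcases hm0.eq_or_lt with h0 | hmpos
    · rw [← h0]
      simpa using (hpos y (Or.inl (hy (mem_ball_self (by norm_num))))).le
    by_cases hyr : ‖y - z‖ < r + k * (ε / 2)
    · refine le_trans ?_ (hiter y hy5 hyr)
      have h1 : (r / 2) ^ n ≤ 1 := pow_le_one₀ (by positivity) (by linarith)
      have h2 : (r / 2) ^ n * g ≤ 1 := mul_le_one₀ h1 hgpos.le hg1
      calc c * m * (r / 2) ^ n * g = c * m * ((r / 2) ^ n * g) := by ring
        _ ≤ c * m * 1 := by gcongr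
        _ = c * m := mul_one _
    · push Not at hyr
      have hypos : 0 < ‖y - z‖ := by linarith
      refine le_trans ?_ (hcomp ε (r + k * (ε / 2)) 5 (c * m) B z u hε (by linarith) (by linarith)
        (by nlinarith) (by positivity) hu hpB hsuper
        (fun x hx => hiter x (ball_subset_ball (by linarith) hx)
          (by rwa [← dist_eq_norm])) y hy5 hyr)
      rw [hg]
      gcongr
      linarith
  rw [Real.rpow_neg hrpos.le, Real.rpow_natCast]
  calc m = 2 ^ n / (c * g) * (r ^ n)⁻¹ * (c * m * (r / 2) ^ n * g) := by
        rw [div_pow]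
        field_simp
    _ ≤ 2 ^ n / (c * g) * (r ^ n)⁻¹ * u y := by gcongr
end
end
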